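/- arXiv:1810.04248 — 2 statements merged into one kernel-verified Lean document; each statement's English description precedes it below -/
import Mathlib

section
/- For every flag g = (V_{d_1} ⊊ ⋯ ⊊ V_{d_k}) in F^n, with d_0 = 0 and d_{k+1} = n, there exists a unique n×n matrix M over F such that: (i) for each j = 1,…,k+1, the first d_j columns of M span V_{d_j} (setting V_{d_{k+1}} = F^n); (ii) every pivot entry of M equals 1; (iii) all entries of M lying in the same row as a pivot and strictly to the right of that pivot are zero; (iv) within each block of columns d_{j-1}+1,…,d_j, all entries lying in the same row as a pivot of a column of that block and strictly to the left of that pivot within the block are zero; (v) within each block of columns d_{j-1}+1,…,d_j, the pivot row indices strictly increase from left to right. -/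
open Matrix

variable {n : ℕ} {F : Type} [Field F]

/-- `(r, j)` is a pivot position of `M`: the entry `M r j` is nonzero and all entries of
column `j` strictly below row `r` vanish (i.e. `r` is the largest row index with `M r j ≠ 0`). -/
def IsPivot (M : Matrix (Fin n) (Fin n) F) (r j : Fin n) : Prop :=
  M r j ≠ 0 ∧ ∀ r' : Fin n, r < r' → M r' j = 0

/-- The span of the first `j` columns of `M` (columns with index `< j` in 0-based indexing). -/
def colSpan (M : Matrix (Fin n) (Fin n) F) (j : ℕ) : Submodule F (Fin n → F) :=
  Submodule.span F ((fun i : Fin n => Mᵀ i) '' {i : Fin n | (i : ℕ) < j})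

/-- A flag: a nonempty finite set of proper nonzero subspaces of `F^n` forming a chain. -/
def IsFlag (g : Set (Submodule F (Fin n → F))) : Prop :=
  g.Finite ∧ g.Nonempty ∧ IsChain (· ≤ ·) g ∧ ∀ V ∈ g, V ≠ ⊥ ∧ V ≠ ⊤

/-- A maximal flag: a flag containing a subspace of every dimension `1,…,n-1`. -/
def IsMaximalFlag (f : Set (Submodule F (Fin n → F))) : Prop :=
  IsFlag f ∧ ∀ j : ℕ, 1 ≤ j → j ≤ n - 1 → ∃ V ∈ f, Module.finrank F V = j

/-- Conditions (i)–(iii) for a matrix representation of a flag `f`: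
(i) for every `V ∈ f` the first `dim V` columns of `M` span `V`, and all `n` columns span `F^n`;
(ii) every pivot entry equals `1`;
(iii) entries in the same row as a pivot and strictly to its right vanish. -/
def IsRep (f : Set (Submodule F (Fin n → F))) (M : Matrix (Fin n) (Fin n) F) : Prop :=
  (∀ V ∈ f, colSpan M (Module.finrank F V) = V) ∧
  colSpan M n = ⊤ ∧
  (∀ r j : Fin n, IsPivot M r j → M r j = 1) ∧
  (∀ r j j' : Fin n, IsPivot M r j → j < j' → M r j' = 0)

/-- Columns `i` and `i'` lie in the same block of the block decomposition induced by the
flag `g` (blocks are the intervals of columns between consecutive dimensions of members of `g`). -/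
def SameBlock (g : Set (Submodule F (Fin n → F))) (i i' : Fin n) : Prop :=
  ∀ V ∈ g, ((i : ℕ) < Module.finrank F V ↔ (i' : ℕ) < Module.finrank F V)

/-- The minimal matrix representation of a flag `g`: conditions (i)–(iii) together with
(iv) within each block, entries in the same row as a pivot of the block and strictly to its left
within the block vanish; (v) within each block, pivot row indices strictly increase. -/
def IsMinRep (g : Set (Submodule F (Fin n → F))) (M : Matrix (Fin n) (Fin n) F) : Prop :=
  IsRep g M ∧
  (∀ r i i' : Fin n, SameBlock g i i' → IsPivot M r i → i' < i → M r i' = 0) ∧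
  (∀ r r' i i' : Fin n, SameBlock g i i' → IsPivot M r i → IsPivot M r' i' → i < i' → r < r')

/-- `σ` is the label of the maximal flag `f`: `σ j` is the pivot row of the `j`-th column of
the minimal matrix representation of `f`. -/
def IsLabel (f : Set (Submodule F (Fin n → F))) (σ : Equiv.Perm (Fin n)) : Prop :=
  ∃ M : Matrix (Fin n) (Fin n) F, IsRep f M ∧ ∀ j : Fin n, IsPivot M (σ j) j

/-- Strict lexicographic order on permutations in one-line notation `(σ 0, …, σ (n-1))`. -/
def LexLt {n : ℕ} (σ τ : Equiv.Perm (Fin n)) : Prop :=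
  ∃ j : Fin n, (∀ i : Fin n, i < j → σ i = τ i) ∧ σ j < τ j

/-- `σ` is the lexicographically least label among the labels of maximal flags containing `g`. -/
def IsMinlabel (g : Set (Submodule F (Fin n → F))) (σ : Equiv.Perm (Fin n)) : Prop :=
  (∃ f, IsMaximalFlag f ∧ g ⊆ f ∧ IsLabel f σ) ∧
  ∀ (f : Set (Submodule F (Fin n → F))) (τ : Equiv.Perm (Fin n)),
    IsMaximalFlag f → g ⊆ f → IsLabel f τ → σ = τ ∨ LexLt σ τ

/-- `t` is a (0-based) ascent of `σ`: `σ t < σ (t+1)`.  (In the 1-based indexing of the paper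
this corresponds to the ascent `(σ(t+1), σ(t+2))` at position `t+1`.) -/
def Ascent {n : ℕ} (σ : Equiv.Perm (Fin n)) (t : ℕ) : Prop :=
  ∃ h : t + 1 < n, σ ⟨t, Nat.lt_of_succ_lt h⟩ < σ ⟨t + 1, h⟩

/-- `σ` is the decreasing permutation `σ(j) = n + 1 - j` (in 0-based indexing, `n - 1 - j`). -/
def IsDecreasing {n : ℕ} (σ : Equiv.Perm (Fin n)) : Prop :=
  ∀ j : Fin n, (σ j : ℕ) = n - 1 - (j : ℕ)

/-- `r` is the pivot row of the vector `v`. -/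
def HasPivotAt (v : Fin n → F) (r : Fin n) : Prop :=
  v r ≠ 0 ∧ ∀ s : Fin n, r < s → v s = 0

theorem HasPivotAt.unique {v : Fin n → F} {r s : Fin n} (hr : HasPivotAt v r)
    (hs : HasPivotAt v s) : r = s := by
  rcases lt_trichotomy r s with h | h | h
  · exact absurd (hr.2 s h) hs.1
  · exact h
  · exact absurd (hs.2 r h) hr.1

theorem exists_hasPivotAt {v : Fin n → F} (hv : v ≠ 0) : ∃ r, HasPivotAt v r := by
  obtain ⟨i, hi⟩ := Function.ne_iff.mp hv
  obtain ⟨r, hr⟩ := (Set.toFinite {i | v i ≠ 0}).exists_maximal ⟨i, hi⟩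
  refine ⟨r, hr.prop, fun s hs => ?_⟩
  by_contra h
  exact hr.not_gt h hs

/-- The set of pivot rows of the vectors of a subspace. -/
def pivotRows (W : Submodule F (Fin n → F)) : Set (Fin n) :=
  {r | ∃ v ∈ W, HasPivotAt v r}

theorem pivotRows_mono {V W : Submodule F (Fin n → F)} (h : V ≤ W) :
    pivotRows V ⊆ pivotRows W :=
  fun _ ⟨v, hv, hr⟩ => ⟨v, h hv, hr⟩

theorem eq_zero_of_forall_pivotRows {W : Submodule F (Fin n → F)} {v : Fin n → F} (hv : v ∈ W)
    (h : ∀ s ∈ pivotRows W, v s = 0) : v = 0 := by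
  by_contra h0
  obtain ⟨r, hr⟩ := exists_hasPivotAt h0
  exact hr.1 (h r ⟨v, hv, hr⟩)

theorem eq_of_forall_pivotRows {W : Submodule F (Fin n → F)} {v w : Fin n → F} (hv : v ∈ W)
    (hw : w ∈ W) (h : ∀ s ∈ pivotRows W, v s = w s) : v = w :=
  sub_eq_zero.mp <| eq_zero_of_forall_pivotRows (W.sub_mem hv hw) fun s hs =>
    sub_eq_zero.mpr (h s hs)

theorem exists_echelon_vector (W : Submodule F (Fin n → F)) (r : Fin n) :
    r ∈ pivotRows W → ∃ v ∈ W, v r = 1 ∧ ∀ s ∈ pivotRows W, s ≠ r → v s = 0 := by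
  classical
  induction r using WellFoundedLT.induction with
  | ind r ih =>
  rintro ⟨v, hv, hvr⟩
  choose! e heW he1 he0 using ih
  let w := (v r)⁻¹ • v
  have hwr : w r = 1 := inv_mul_cancel₀ hvr.1
  let T := Finset.univ.filter fun s => s < r ∧ s ∈ pivotRows W
  have hT {s : Fin n} : s ∈ T ↔ s < r ∧ s ∈ pivotRows W := by simp [T]
  refine ⟨w - ∑ s ∈ T, w s • e s, W.sub_mem (W.smul_mem _ hv)
    (W.sum_mem fun s hs => W.smul_mem _ (heW s (hT.1 hs).1 (hT.1 hs).2)), ?_, ?_⟩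
  · have : ∑ s ∈ T, (w s • e s) r = 0 := Finset.sum_eq_zero fun s hs => by
      have := he0 s (hT.1 hs).1 (hT.1 hs).2 r ⟨v, hv, hvr⟩ (hT.1 hs).1.ne'
      simp [this]
    rw [Pi.sub_apply, Finset.sum_apply, this, hwr, sub_zero]
  · intro t ht htr
    have hoff (s) (hs : s ∈ T) (hst : s ≠ t) : (w s • e s) t = 0 := by
      have := he0 s (hT.1 hs).1 (hT.1 hs).2 t ht hst.symm
      simp [this]
    rw [Pi.sub_apply, Finset.sum_apply]
    rcases lt_or_gt_of_ne htr with h | h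
    · rw [Finset.sum_eq_single_of_mem t (hT.2 ⟨h, ht⟩) fun s hs hst => hoff s hs hst]
      simp [he1 t h ht]
    · rw [Finset.sum_eq_zero fun s hs => hoff s hs ((hT.1 hs).1.trans h).ne]
      simp [w, hvr.2 t h]

theorem hasPivotAt_of_echelon {W : Submodule F (Fin n → F)} {v : Fin n → F} {r : Fin n}
    (hv : v ∈ W) (h1 : v r = 1) (h0 : ∀ s ∈ pivotRows W, s ≠ r → v s = 0) :
    HasPivotAt v r := by
  obtain ⟨p, hp⟩ := exists_hasPivotAt (v := v) (by rintro rfl; simp at h1)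
  have : p = r := by
    by_contra h
    exact hp.1 (h0 p ⟨v, hv, hp⟩ h)
  exact this ▸ hp

theorem ncard_pivotRows (W : Submodule F (Fin n → F)) :
    (pivotRows W).ncard = Module.finrank F W := by
  classical
  choose! e heW he1 he0 using exists_echelon_vector W
  let f : W →ₗ[F] (pivotRows W → F) :=
    LinearMap.funLeft F F (Subtype.val : pivotRows W → Fin n) ∘ₗ W.subtype
  have hf : Function.Bijective f := by
    constructor
    · rintro ⟨v, hv⟩ ⟨w, hw⟩ h
      exact Subtype.ext (eq_of_forall_pivotRows hv hw fun s hs => congrFun h ⟨s, hs⟩)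
    · intro y
      refine ⟨⟨∑ s, y s • e s, W.sum_mem fun s _ => W.smul_mem _ (heW s s.2)⟩, ?_⟩
      ext t
      change (∑ s, y s • e s) t.1 = y t
      rw [Finset.sum_apply, Finset.sum_eq_single t]
      · simp [he1 t t.2]
      · intro s _ hst
        simp [he0 s s.2 t t.2 fun h => hst (Subtype.ext h.symm)]
      · simp
  rw [(LinearEquiv.ofBijective f hf).finrank_eq, Module.finrank_fintype_fun_eq_card,
    ← Nat.card_coe_set_eq, Nat.card_eq_fintype_card]

theorem finrank_le (W : Submodule F (Fin n → F)) : Module.finrank F W ≤ n := by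
  simpa using W.finrank_le

theorem ncard_val_lt {d : ℕ} (hd : d ≤ n) : {i : Fin n | (i : ℕ) < d}.ncard = d := by
  rw [Set.ncard_eq_toFinset_card']
  simp [Fin.card_filter_val_lt, hd]

theorem ncard_preimage_perm (σ : Equiv.Perm (Fin n)) (S : Set (Fin n)) :
    {i | σ i ∈ S}.ncard = S.ncard :=
  Set.ncard_preimage_of_injective_subset_range σ.injective (by simp [σ.surjective.range_eq])

/-- The number of members of `g` having no vector with pivot row `r`. -/
noncomputable def pivotLevel (g : Set (Submodule F (Fin n → F))) (r : Fin n) : ℕ :=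
  {V ∈ g | r ∉ pivotRows V}.ncard

/-- `σ` enumerates the pivot rows of each member `V` of `g` in its first `dim V` positions. -/
def IsCompatible (g : Set (Submodule F (Fin n → F))) (σ : Equiv.Perm (Fin n)) : Prop :=
  ∀ V ∈ g, ∀ i : Fin n, σ i ∈ pivotRows V ↔ (i : ℕ) < Module.finrank F V

section Flag

variable {g : Set (Submodule F (Fin n → F))}

theorem pivotLevel_lt (hfin : g.Finite) (hch : IsChain (· ≤ ·) g)
    {V : Submodule F (Fin n → F)} (hV : V ∈ g) {r s : Fin n} (hr : r ∈ pivotRows V)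
    (hs : s ∉ pivotRows V) : pivotLevel g r < pivotLevel g s := by
  refine Set.ncard_lt_ncard ?_ (hfin.subset fun _ h => h.1)
  refine ⟨fun U ⟨hU, hrU⟩ => ⟨hU, fun hsU => ?_⟩, fun h => (h ⟨hV, hs⟩).2 hr⟩
  rcases hch.total hU hV with h | h
  · exact hs (pivotRows_mono h hsU)
  · exact hrU (pivotRows_mono h hr)

theorem isCompatible_sort (hfin : g.Finite) (hch : IsChain (· ≤ ·) g) :
    IsCompatible g (Tuple.sort (pivotLevel g)) := by
  intro V hV i
  set σ := Tuple.sort (pivotLevel g)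
  have hmono : Monotone (pivotLevel g ∘ σ) := Tuple.monotone_sort _
  have hcard : {i | σ i ∈ pivotRows V}.ncard = Module.finrank F V := by
    rw [ncard_preimage_perm, ncard_pivotRows]
  have hlow {a b : Fin n} (hab : a ≤ b) (hb : σ b ∈ pivotRows V) : σ a ∈ pivotRows V := by
    by_contra ha
    exact (pivotLevel_lt hfin hch hV hb ha).not_ge (hmono hab)
  constructor
  · intro hi
    have : {j : Fin n | (j : ℕ) < i + 1}.ncard ≤ {i | σ i ∈ pivotRows V}.ncard :=
      Set.ncard_le_ncard fun j hj => hlow (Nat.lt_succ_iff.mp hj) hi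
    rw [ncard_val_lt i.2, hcard] at this
    exact this
  · intro hi
    by_contra h
    have : {i | σ i ∈ pivotRows V}.ncard ≤ {j : Fin n | (j : ℕ) < i}.ncard :=
      Set.ncard_le_ncard fun j hj => lt_of_not_ge fun hij : i ≤ j => h (hlow hij hj)
    rw [ncard_val_lt i.2.le, hcard] at this
    omega

theorem IsCompatible.insert_top {σ : Equiv.Perm (Fin n)} (h : IsCompatible g σ) :
    IsCompatible (insert ⊤ g) σ := by
  classical
  rintro V (rfl | hV) i
  · have : HasPivotAt (Pi.single (σ i) (1 : F) : Fin n → F) (σ i) :=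
      ⟨by simp, fun s hs => by simp [hs.ne']⟩
    simpa using ⟨_, Submodule.mem_top, this⟩
  · exact h V hV i

theorem IsCompatible.pivotLevel_apply {σ : Equiv.Perm (Fin n)} (h : IsCompatible g σ)
    (i : Fin n) :
    pivotLevel g (σ i) = {V ∈ g | ¬ (i : ℕ) < Module.finrank F V}.ncard := by
  unfold pivotLevel
  congr 1
  ext V
  exact and_congr_right fun hV => not_congr (h V hV i)

theorem IsCompatible.pivotLevel_eq {σ : Equiv.Perm (Fin n)} (h : IsCompatible g σ)
    {i j : Fin n} (hij : SameBlock g i j) : pivotLevel g (σ i) = pivotLevel g (σ j) := by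
  rw [h.pivotLevel_apply, h.pivotLevel_apply]
  congr 1
  ext V
  exact and_congr_right fun hV => not_congr (hij V hV)

/-- A compatible permutation that is increasing on blocks sorts the rows by level. -/
theorem IsCompatible.eq_sort {σ : Equiv.Perm (Fin n)} (hfin : g.Finite) (h : IsCompatible g σ)
    (hblock : ∀ i j, SameBlock g i j → i < j → σ i < σ j) :
    σ = Tuple.sort (pivotLevel g) := by
  have hsub {i j : Fin n} (hij : i ≤ j) : {V ∈ g | ¬ (i : ℕ) < Module.finrank F V} ⊆
      {V ∈ g | ¬ (j : ℕ) < Module.finrank F V} :=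
    fun V hV => ⟨hV.1, fun hj => hV.2 (lt_of_le_of_lt hij hj)⟩
  have hfin' (j : Fin n) : {V ∈ g | ¬ (j : ℕ) < Module.finrank F V}.Finite :=
    hfin.subset fun _ h => h.1
  refine Tuple.eq_sort_iff.mpr ⟨fun i j hij => ?_, fun i j hij heq => hblock i j ?_ hij⟩
  · simp only [Function.comp_apply, h.pivotLevel_apply]
    exact Set.ncard_le_ncard (hsub hij) (hfin' j)
  · rw [h.pivotLevel_apply, h.pivotLevel_apply] at heq
    have := Set.eq_of_subset_of_ncard_le (hsub hij.le) heq.ge (hfin' j)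
    intro V hV
    have := Set.ext_iff.mp this V
    simp only [Set.mem_ofPred_eq, hV, true_and] at this
    exact not_iff_not.mp this

/-- Each column index `i` lies below the dimension of a least member of `g ∪ {F^n}`. -/
theorem exists_least_member (hfin : g.Finite) (hch : IsChain (· ≤ ·) g) (i : Fin n) :
    ∃ W ∈ insert ⊤ g, (i : ℕ) < Module.finrank F W ∧
      ∀ V ∈ insert ⊤ g, (i : ℕ) < Module.finrank F V → W ≤ V := by
  have hch' : IsChain (· ≤ ·) (insert ⊤ g) := hch.insert fun _ _ _ => Or.inr le_top
  obtain ⟨W, hW⟩ := ((hfin.insert ⊤).subset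
    (fun _ h => h.1 : {V ∈ insert ⊤ g | (i : ℕ) < Module.finrank F V} ⊆ _)).exists_minimal
    ⟨⊤, Set.mem_insert _ _, by simp⟩
  refine ⟨W, hW.prop.1, hW.prop.2, fun V hV hiV => ?_⟩
  exact (hch'.total hW.prop.1 hV).elim id fun h => hW.le_of_le ⟨hV, hiV⟩ h

/-- If column `i` has pivot row `σ i` and lies in every member of `g ∪ {F^n}` of dimension
greater than `i`, then the leading columns span the members of `g ∪ {F^n}`. -/
theorem IsCompatible.colSpan_eq {σ : Equiv.Perm (Fin n)} (h : IsCompatible g σ)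
    {M : Matrix (Fin n) (Fin n) F} (hpiv : ∀ i, HasPivotAt (Mᵀ i) (σ i))
    {V : Submodule F (Fin n → F)} (hV : V ∈ g)
    (hmem : ∀ i : Fin n, (i : ℕ) < Module.finrank F V → Mᵀ i ∈ V) :
    colSpan M (Module.finrank F V) = V := by
  have hle : colSpan M (Module.finrank F V) ≤ V := by
    refine Submodule.span_le.mpr ?_
    rintro _ ⟨i, hi, rfl⟩
    exact hmem i hi
  refine Submodule.eq_of_le_of_finrank_le hle ?_
  refine (ncard_pivotRows V).symm.trans_le (le_trans ?_ (ncard_pivotRows _).le)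
  refine Set.ncard_le_ncard fun r hr => ?_
  obtain ⟨i, rfl⟩ := σ.surjective r
  exact ⟨_, Submodule.subset_span ⟨i, (h V hV i).mp hr, rfl⟩, hpiv i⟩

theorem exists_isMinRep (hfin : g.Finite) (hch : IsChain (· ≤ ·) g) :
    ∃ M : Matrix (Fin n) (Fin n) F, IsMinRep g M := by
  set σ := Tuple.sort (pivotLevel g) with hσ
  have hg : IsCompatible g σ := isCompatible_sort hfin hch
  have hG := hg.insert_top
  choose W hWG hWi hWle using exists_least_member hfin hch
  choose e heW he1 he0 using fun i =>
    exists_echelon_vector (W i) (σ i) ((hG _ (hWG i) i).mpr (hWi i))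
  have hpiv (i) : HasPivotAt (e i) (σ i) := hasPivotAt_of_echelon (heW i) (he1 i) (he0 i)
  have hzero {i j : Fin n} (hij : i ≠ j) (hi : (i : ℕ) < Module.finrank F (W j)) :
      e j (σ i) = 0 :=
    he0 j _ ((hG _ (hWG j) i).mpr hi) (σ.injective.ne hij)
  have hspan {V} (hV : V ∈ insert ⊤ g) : colSpan (Matrix.of e)ᵀ (Module.finrank F V) = V :=
    hG.colSpan_eq hpiv hV fun i hi => hWle i V hV hi (heW i)
  have hrow {r i : Fin n} (h : IsPivot (Matrix.of e)ᵀ r i) : r = σ i :=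
    HasPivotAt.unique h (hpiv i)
  refine ⟨(Matrix.of e)ᵀ, ⟨fun V hV => hspan (Or.inr hV), ?_, ?_, ?_⟩, ?_, ?_⟩
  · simpa using hspan (Set.mem_insert ⊤ g)
  · intro r j h
    rw [hrow h]
    exact he1 j
  · intro r j j' h hjj'
    rw [hrow h]
    exact hzero hjj'.ne (lt_trans hjj' (hWi j'))
  · intro r i i' hb h hi
    rw [hrow h]
    refine hzero hi.ne' ?_
    rcases hWG i' with hT | hV
    · rw [hT]; simp
    · exact (hb _ hV).mpr (hWi i')
  · intro r r' i i' hb h h' hi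
    rw [hrow h, hrow h']
    exact (Tuple.eq_sort_iff.mp hσ).2 i i' hi (hg.pivotLevel_eq hb)

/-- The pivot rows of a matrix representation form a permutation compatible with the flag. -/
theorem IsRep.exists_perm {M : Matrix (Fin n) (Fin n) F} (hM : IsRep g M) :
    ∃ σ : Equiv.Perm (Fin n), (∀ i, IsPivot M (σ i) i) ∧ IsCompatible g σ := by
  obtain ⟨hspan, htop, -, hright⟩ := hM
  have hli : LinearIndependent F fun i => Mᵀ i := by
    refine linearIndependent_of_top_le_span_of_card_eq_finrank ?_ (by simp)
    rw [← htop]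
    exact Submodule.span_mono (Set.image_subset_range _ _)
  choose p hp using fun i => exists_hasPivotAt (hli.ne_zero i)
  have hlt {i j : Fin n} (hij : i < j) : p i ≠ p j := fun h =>
    (hp j).1 (h ▸ hright (p i) i j (hp i) hij)
  have hinj : Function.Injective p := fun i j h => by
    by_contra hne
    rcases lt_or_gt_of_ne hne with hij | hij
    · exact hlt hij h
    · exact hlt hij h.symm
  refine ⟨Equiv.ofBijective p (Finite.injective_iff_bijective.mp hinj), hp, fun V hV i => ?_⟩
  set σ := Equiv.ofBijective p (Finite.injective_iff_bijective.mp hinj)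
  have hsub : {j : Fin n | (j : ℕ) < Module.finrank F V} ⊆ {j | σ j ∈ pivotRows V} :=
    fun j hj => ⟨Mᵀ j, hspan V hV ▸ Submodule.subset_span ⟨j, hj, rfl⟩, hp j⟩
  have := Set.eq_of_subset_of_ncard_le hsub (by
    rw [ncard_preimage_perm, ncard_pivotRows, ncard_val_lt (finrank_le V)])
  exact (Set.ext_iff.mp this i).symm

theorem IsMinRep.unique (hfin : g.Finite) (hch : IsChain (· ≤ ·) g)
    {M N : Matrix (Fin n) (Fin n) F} (hM : IsMinRep g M) (hN : IsMinRep g N) : M = N := by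
  have key {M : Matrix (Fin n) (Fin n) F} (hM : IsMinRep g M) :
      ∀ i, IsPivot M (Tuple.sort (pivotLevel g) i) i := by
    obtain ⟨σ, hp, hσ⟩ := hM.1.exists_perm
    rw [← hσ.eq_sort hfin fun i j hb hij => hM.2.2 _ _ i j hb (hp i) (hp j) hij]
    exact hp
  have hG := (isCompatible_sort hfin hch).insert_top
  set σ := Tuple.sort (pivotLevel g)
  refine Matrix.transpose_injective (funext fun i => ?_)
  obtain ⟨W, hW, hiW, hle⟩ := exists_least_member hfin hch i
  have hmem {M : Matrix (Fin n) (Fin n) F} (hM : IsMinRep g M) : Mᵀ i ∈ W := by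
    rcases hW with rfl | hW
    · exact Submodule.mem_top
    · rw [← hM.1.1 W hW]
      exact Submodule.subset_span ⟨i, hiW, rfl⟩
  have hval {M : Matrix (Fin n) (Fin n) F} (hM : IsMinRep g M) {j : Fin n}
      (hj : (j : ℕ) < Module.finrank F W) : M (σ j) i = if j = i then 1 else 0 := by
    split_ifs with h
    · subst h
      exact hM.1.2.2.1 _ _ (key hM j)
    · rcases lt_or_gt_of_ne h with h | h
      · exact hM.1.2.2.2 _ _ _ (key hM j) h
      · refine hM.2.1 _ j i (fun V hV => ⟨lt_trans h, fun hi => ?_⟩) (key hM j) h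
        exact hj.trans_le (Submodule.finrank_mono (hle V (Or.inr hV) hi))
  refine eq_of_forall_pivotRows (hmem hM) (hmem hN) fun s hs => ?_
  obtain ⟨j, rfl⟩ := σ.surjective s
  have hj := (hG W hW j).mp hs
  exact (hval hM hj).trans (hval hN hj).symm

end Flag

/-- every flag has a unique minimal matrix representation
satisfying conditions (i)–(v). -/
theorem flag_unique_minimal_matrix_representation
    [Fintype F] (hn : 2 ≤ n)
    (g : Set (Submodule F (Fin n → F))) (hg : IsFlag g) :
    ∃! M : Matrix (Fin n) (Fin n) F, IsMinRep g M := by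
  obtain ⟨hfin, -, hch, -⟩ := hg
  obtain ⟨M, hM⟩ := exists_isMinRep hfin hch
  exact ⟨M, hM, fun N hN => hN.unique hfin hch hM⟩
end

section
/- If f and h are two distinct maximal flags in F^n having the same label σ, then there is no flag g with g ⊆ f, g ⊆ h, and minlabel(g) = σ; that is, two different maximal flags with the same label σ do not have a common face lying in X_σ. -/
open Matrix

variable {n : ℕ} {F : Type} [Field F]

lemma IsPivot.row_unique {M : Matrix (Fin n) (Fin n) F} {r s j : Fin n}
    (hr : IsPivot M r j) (hs : IsPivot M s j) : r = s := by
  rcases lt_trichotomy r s with h | h | h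
  · exact absurd (hr.2 s h) hs.1
  · exact h
  · exact absurd (hs.2 r h) hr.1

lemma exists_pivot_mulVec {M : Matrix (Fin n) (Fin n) F} {σ : Equiv.Perm (Fin n)}
    (hM : ∀ j, IsPivot M (σ j) j) {a : Fin n → F} (ha : a ≠ 0) :
    ∃ i, a i ≠ 0 ∧ (M *ᵥ a) (σ i) ≠ 0 ∧ ∀ r, σ i < r → (M *ᵥ a) r = 0 := by
  classical
  obtain ⟨i₀, hi₀⟩ := Function.ne_iff.mp ha
  obtain ⟨i, hi, hmax⟩ := Finset.exists_max_image (Finset.univ.filter fun i => a i ≠ 0) σ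
    ⟨i₀, by simpa using hi₀⟩
  simp only [Finset.mem_filter, Finset.mem_univ, true_and] at hi hmax
  have hle : ∀ x, x ≠ i → ∀ r, σ i ≤ r → M r x * a x = 0 := by
    intro x hx r hr
    by_cases hax : a x = 0
    · simp [hax]
    · have hlt : σ x < σ i := lt_of_le_of_ne (hmax x hax) fun e => hx (σ.injective e)
      rw [(hM x).2 r (hlt.trans_le hr), zero_mul]
  refine ⟨i, hi, ?_, fun r hr => ?_⟩
  · have hsum : (M *ᵥ a) (σ i) = M (σ i) i * a i := by
      rw [mulVec, dotProduct]
      exact Finset.sum_eq_single i (fun x _ hx => hle x hx _ le_rfl) (by simp)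
    rw [hsum]
    exact mul_ne_zero (hM i).1 hi
  · rw [mulVec, dotProduct]
    refine Finset.sum_eq_zero fun x _ => ?_
    by_cases hx : x = i
    · subst hx
      simp [(hM x).2 r hr]
    · exact hle x hx r hr.le

lemma col_mem_colSpan (M : Matrix (Fin n) (Fin n) F) {i : Fin n} {m : ℕ} (hi : (i : ℕ) < m) :
    Mᵀ i ∈ colSpan M m :=
  Submodule.subset_span ⟨i, hi, rfl⟩

lemma colSpan_mono (M : Matrix (Fin n) (Fin n) F) : Monotone (colSpan M) :=
  fun _ _ hab => Submodule.span_mono (Set.image_mono fun _ hi => lt_of_lt_of_le hi hab)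

lemma exists_mulVec_of_mem_colSpan {M : Matrix (Fin n) (Fin n) F} {m : ℕ} {w : Fin n → F}
    (hw : w ∈ colSpan M m) : ∃ a : Fin n → F, (∀ i : Fin n, m ≤ i → a i = 0) ∧ M *ᵥ a = w := by
  induction hw using Submodule.span_induction with
  | mem x hx =>
    obtain ⟨i, hi, rfl⟩ := hx
    refine ⟨Pi.single i 1, fun i' hi' => ?_, ?_⟩
    · have hne : i' ≠ i := by
        rintro rfl
        exact absurd hi (not_lt.mpr hi')
      simp [hne]
    · ext r
      simp
  | zero => exact ⟨0, by simp, by simp⟩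
  | add x y _ _ hx hy =>
    obtain ⟨a, ha, rfl⟩ := hx
    obtain ⟨b, hb, rfl⟩ := hy
    exact ⟨a + b, fun i hi => by simp [ha i hi, hb i hi], by rw [mulVec_add]⟩
  | smul c x _ hx =>
    obtain ⟨a, ha, rfl⟩ := hx
    exact ⟨c • a, fun i hi => by simp [ha i hi], by rw [mulVec_smul]⟩

lemma finrank_colSpan {M : Matrix (Fin n) (Fin n) F} {σ : Equiv.Perm (Fin n)}
    (hM : ∀ j, IsPivot M (σ j) j) {m : ℕ} (hm : m ≤ n) :
    Module.finrank F (colSpan M m) = m := by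
  have hli : LinearIndependent F M.col := by
    rw [← mulVec_injective_iff]
    intro a b hab
    by_contra hne
    obtain ⟨i, -, hi, -⟩ := exists_pivot_mulVec hM (sub_ne_zero.mpr hne)
    exact hi (by rw [mulVec_sub]; simp [show M *ᵥ a = M *ᵥ b from hab])
  have hspan : colSpan M m = Submodule.span F (Set.range (M.col ∘ Fin.castLE hm)) := by
    rw [colSpan, Set.range_comp]
    congr 2
    ext i
    constructor
    · exact fun hi => ⟨⟨i, hi⟩, rfl⟩
    · rintro ⟨x, rfl⟩
      exact x.2
  rw [hspan, finrank_span_eq_card (hli.comp _ (Fin.castLE_injective hm)), Fintype.card_fin]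

/-- The pivot row of a vector in the span of the first `m` columns is the pivot row of one of
these columns. -/
lemma lt_of_pivot_of_mem_colSpan {M : Matrix (Fin n) (Fin n) F} {σ : Equiv.Perm (Fin n)}
    (hM : ∀ j, IsPivot M (σ j) j) {m : ℕ} {w : Fin n → F} (hw : w ∈ colSpan M m) {k : Fin n}
    (hk : w (σ k) ≠ 0) (hk' : ∀ r, σ k < r → w r = 0) : (k : ℕ) < m := by
  obtain ⟨a, ha, rfl⟩ := exists_mulVec_of_mem_colSpan hw
  have ha0 : a ≠ 0 := by
    rintro rfl
    simp at hk
  obtain ⟨i, hai, hi, hi'⟩ := exists_pivot_mulVec hM ha0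
  have hik : i = k := by
    apply σ.injective
    rcases lt_trichotomy (σ i) (σ k) with h | h | h
    · exact absurd (hi' _ h) hk
    · exact h
    · exact absurd (hk' _ h) hi
  subst hik
  by_contra hlt
  exact hai (ha i (not_lt.mp hlt))

lemma finrank_pos_and_lt_of_isFlag {g : Set (Submodule F (Fin n → F))} (hg : IsFlag g)
    {V : Submodule F (Fin n → F)} (hV : V ∈ g) :
    1 ≤ Module.finrank F V ∧ Module.finrank F V < n := by
  obtain ⟨hbot, htop⟩ := hg.2.2.2 V hV
  refine ⟨Submodule.one_le_finrank_iff.mpr hbot, ?_⟩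
  simpa using Submodule.finrank_lt htop

/-- The maximal flag spanned by the columns of a matrix. -/
def colFlag (M : Matrix (Fin n) (Fin n) F) : Set (Submodule F (Fin n → F)) :=
  colSpan M '' Set.Icc 1 (n - 1)

lemma isMaximalFlag_colFlag (hn : 2 ≤ n) {M : Matrix (Fin n) (Fin n) F}
    {σ : Equiv.Perm (Fin n)} (hM : ∀ j, IsPivot M (σ j) j) : IsMaximalFlag (colFlag M) := by
  refine ⟨⟨(Set.finite_Icc _ _).image _, ⟨_, 1, ⟨le_rfl, by omega⟩, rfl⟩, ?_, ?_⟩, ?_⟩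
  · rintro _ ⟨a, -, rfl⟩ _ ⟨b, -, rfl⟩ -
    exact (le_total a b).imp (fun h => colSpan_mono M h) (fun h => colSpan_mono M h)
  · rintro _ ⟨a, ⟨h1, h2⟩, rfl⟩
    have hfin := finrank_colSpan hM (show a ≤ n by omega)
    constructor
    · intro h
      rw [h, finrank_bot] at hfin
      omega
    · intro h
      rw [h, finrank_top, Module.finrank_fin_fun] at hfin
      omega
  · exact fun j h1 h2 => ⟨_, ⟨j, ⟨h1, h2⟩, rfl⟩, finrank_colSpan hM (by omega)⟩

/-- Exchange columns `j` and `k`, and clear row `r` to the right of column `j`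
using the old column `k`. -/
def swapCols (M : Matrix (Fin n) (Fin n) F) (r j k : Fin n) : Matrix (Fin n) (Fin n) F :=
  fun x i => M x (Equiv.swap j k i) -
    if j < i then M r (Equiv.swap j k i) * M x k else 0

lemma swap_apply_cases {j k : Fin n} (i : Fin n) :
    (i = j ∧ Equiv.swap j k i = k) ∨ (i = k ∧ Equiv.swap j k i = j) ∨
      (i ≠ j ∧ i ≠ k ∧ Equiv.swap j k i = i) := by
  by_cases h1 : i = j
  · simp [h1]
  by_cases h2 : i = k
  · simp [h2]
  · exact Or.inr (Or.inr ⟨h1, h2, Equiv.swap_apply_of_ne_of_ne h1 h2⟩)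

lemma swapCols_apply_of_le {M : Matrix (Fin n) (Fin n) F} {σ : Equiv.Perm (Fin n)}
    (hM : ∀ j, IsPivot M (σ j) j) {j k : Fin n} (i : Fin n)
    {x : Fin n} (hx : σ (Equiv.swap j k i) ≤ x) :
    swapCols M (σ k) j k x i = M x (Equiv.swap j k i) := by
  unfold swapCols
  split_ifs with hji
  · have hne : Equiv.swap j k i ≠ k := by
      rw [Ne, Equiv.swap_apply_eq_iff, Equiv.swap_apply_right]
      exact hji.ne'
    rcases lt_or_gt_of_ne (fun e => hne (σ.injective e)) with h | h
    · rw [(hM _).2 _ h]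
      ring
    · rw [(hM k).2 _ (h.trans_le hx)]
      ring
  · ring

lemma isPivot_swapCols {M : Matrix (Fin n) (Fin n) F} {σ : Equiv.Perm (Fin n)}
    (hM : ∀ j, IsPivot M (σ j) j) (j k i : Fin n) :
    IsPivot (swapCols M (σ k) j k) ((σ * Equiv.swap j k) i) i := by
  rw [Equiv.Perm.mul_apply]
  refine ⟨?_, fun r hr => ?_⟩
  · rw [swapCols_apply_of_le hM i le_rfl]
    exact (hM _).1
  · rw [swapCols_apply_of_le hM i hr.le]
    exact (hM _).2 r hr

lemma colSpan_swapCols {M : Matrix (Fin n) (Fin n) F} {σ : Equiv.Perm (Fin n)}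
    (hM : ∀ j, IsPivot M (σ j) j) {j k : Fin n} (hjk : j < k) {m : ℕ} (hm : m ≤ n)
    (hjkm : m ≤ j ∨ (k : ℕ) < m) :
    colSpan (swapCols M (σ k) j k) m = colSpan M m := by
  apply Submodule.eq_of_le_of_finrank_eq
  · refine Submodule.span_le.mpr ?_
    rintro _ ⟨i, hi, rfl⟩
    have hi' : (i : ℕ) < m := hi
    have hjk' : (j : ℕ) < k := hjk
    have hcol : (swapCols M (σ k) j k)ᵀ i = Mᵀ (Equiv.swap j k i) -
        (if j < i then M (σ k) (Equiv.swap j k i) else 0) • Mᵀ k := by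
      ext x
      by_cases h : j < i <;> simp [swapCols, h]
    have hs : ((Equiv.swap j k i : Fin n) : ℕ) < m := by
      rcases swap_apply_cases (j := j) (k := k) i with ⟨h, h'⟩ | ⟨h, h'⟩ | ⟨-, -, h'⟩ <;>
        rw [h'] <;> omega
    change (swapCols M (σ k) j k)ᵀ i ∈ colSpan M m
    rw [hcol]
    refine Submodule.sub_mem _ (col_mem_colSpan M hs) ?_
    split_ifs with hji
    · exact Submodule.smul_mem _ _ (col_mem_colSpan M (by omega))
    · simp
  · rw [finrank_colSpan hM hm, finrank_colSpan (isPivot_swapCols hM j k) hm]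

lemma isLabel_colFlag_swapCols {f : Set (Submodule F (Fin n → F))}
    {M : Matrix (Fin n) (Fin n) F} {σ : Equiv.Perm (Fin n)}
    (hrep : IsRep f M) (hM : ∀ j, IsPivot M (σ j) j) {j k : Fin n} (hjk : (k : ℕ) = j + 1) :
    IsLabel (colFlag (swapCols M (σ k) j k)) (σ * Equiv.swap j k) := by
  obtain ⟨-, htop, hone, hzero⟩ := hrep
  have hp := isPivot_swapCols hM j k
  have hlt : j < k := Fin.lt_def.mpr (by omega)
  have hz : ∀ i i', i < i' → M (σ i) i' = 0 := fun i i' => hzero _ _ _ (hM i)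
  refine ⟨swapCols M (σ k) j k, ⟨?_, ?_, ?_, ?_⟩, hp⟩
  · rintro _ ⟨a, ⟨h1, h2⟩, rfl⟩
    rw [finrank_colSpan hp (by omega)]
  · rw [colSpan_swapCols hM hlt le_rfl (Or.inr k.2), htop]
  · intro r i hri
    rw [hri.row_unique (hp i), Equiv.Perm.mul_apply, swapCols_apply_of_le hM i le_rfl]
    exact hone _ _ (hM _)
  · intro r i i' hri hii'
    rw [hri.row_unique (hp i), Equiv.Perm.mul_apply]
    unfold swapCols
    rcases swap_apply_cases (j := j) (k := k) i with ⟨h, e⟩ | ⟨h, e⟩ | ⟨h, h₂, e⟩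
    · subst h
      rw [e, if_pos hii', hone _ _ (hM k)]
      ring
    · subst h
      rw [e, Equiv.swap_apply_of_ne_of_ne (hlt.trans hii').ne' hii'.ne', hz j i' (hlt.trans hii'),
        hz i i' hii']
      simp
    · have hs : i < Equiv.swap j k i' := by
        rcases swap_apply_cases (j := j) (k := k) i' with ⟨h', e'⟩ | ⟨h', e'⟩ | ⟨-, -, e'⟩ <;>
          rw [e'] <;> omega
      rw [e, hz _ _ hs]
      split_ifs with hji
      · by_cases hik : i < k
        · rw [hz i k hik]
          ring
        · rw [hz k _ (by
            rw [Equiv.swap_apply_of_ne_of_ne (by omega) (by omega)]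
            omega)]
          ring
      · simp

lemma not_le_mul_swap {σ : Equiv.Perm (Fin n)} {j k : Fin n} (hjk : j < k) (hσ : σ k < σ j) :
    ¬ (σ = σ * Equiv.swap j k ∨ LexLt σ (σ * Equiv.swap j k)) := by
  have hτj : (σ * Equiv.swap j k) j = σ k := by simp
  rintro (h | ⟨i, hi, hlt⟩)
  · rw [← h] at hτj
    exact hσ.ne hτj.symm
  · rcases lt_trichotomy i j with h | h | h
    · rw [Equiv.Perm.mul_apply, Equiv.swap_apply_of_ne_of_ne h.ne (h.trans hjk).ne] at hlt
      exact lt_irrefl _ hlt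
    · subst h
      rw [hτj] at hlt
      exact lt_asymm hlt hσ
    · exact hσ.ne ((hi j h).trans hτj).symm

lemma exists_adjacent_descent {σ : Equiv.Perm (Fin n)} {j k : Fin n} (hjk : j < k)
    (hσ : σ k < σ j) :
    ∃ s t : Fin n, (t : ℕ) = s + 1 ∧ j ≤ s ∧ t ≤ k ∧ σ t < σ s := by
  by_contra! hno
  have hmono : ∀ m (hm : m < n), (j : ℕ) ≤ m → m ≤ k → σ j ≤ σ ⟨m, hm⟩ := by
    intro m hm hjm
    induction m, hjm using Nat.le_induction with
    | base => exact fun _ => le_rfl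
    | succ m hjm ih =>
      exact fun hmk => (ih (by omega) (by omega)).trans
        (hno ⟨m, by omega⟩ ⟨m + 1, hm⟩ rfl hjm hmk)
  exact absurd (hmono k k.2 hjk.le le_rfl) (not_le.mpr hσ)

/-- A minimal label increases on every block. -/
lemma IsMinlabel.lt_of_sameBlock (hn : 2 ≤ n) {f g : Set (Submodule F (Fin n → F))}
    {M : Matrix (Fin n) (Fin n) F} {σ : Equiv.Perm (Fin n)} (hg : IsFlag g) (hgf : g ⊆ f)
    (hrep : IsRep f M) (hM : ∀ j, IsPivot M (σ j) j) (hmin : IsMinlabel g σ)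
    {j k : Fin n} (hjk : j < k) (hblock : SameBlock g j k) : σ j < σ k := by
  by_contra hnot
  obtain ⟨s, t, hst, hjs, htk, hσ⟩ := exists_adjacent_descent hjk
    (lt_of_le_of_ne (not_lt.mp hnot) fun e => hjk.ne' (σ.injective e))
  have hlt : s < t := Fin.lt_def.mpr (by omega)
  refine not_le_mul_swap hlt hσ (hmin.2 _ _ (isMaximalFlag_colFlag hn (isPivot_swapCols hM s t))
    (fun V hV => ?_) (isLabel_colFlag_swapCols hrep hM hst))
  obtain ⟨h1, h2⟩ := finrank_pos_and_lt_of_isFlag hg hV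
  have hb := hblock V hV
  refine ⟨Module.finrank F V, ⟨h1, by omega⟩, ?_⟩
  rw [colSpan_swapCols hM hlt h2.le (by omega)]
  exact hrep.1 V (hgf hV)

lemma IsMaximalFlag.subset_of_isRep {f h : Set (Submodule F (Fin n → F))}
    {M : Matrix (Fin n) (Fin n) F} (hf : IsMaximalFlag f) (hh : IsMaximalFlag h)
    (hfM : IsRep f M) (hhM : IsRep h M) : f ⊆ h := by
  intro V hV
  obtain ⟨h1, h2⟩ := finrank_pos_and_lt_of_isFlag hf.1 hV
  obtain ⟨W, hW, hWV⟩ := hh.2 _ h1 (by omega)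
  rwa [← hfM.1 V hV, ← hWV, hhM.1 W hW]

/-- two different maximal flags with the same label `σ` do not have a common
face lying in `X_σ`. -/
theorem no_common_face_in_X_sigma
    [Fintype F] (hn : 2 ≤ n)
    (f h : Set (Submodule F (Fin n → F)))
    (hf : IsMaximalFlag f) (hh : IsMaximalFlag h) (hne : f ≠ h)
    (σ : Equiv.Perm (Fin n)) (hfσ : IsLabel f σ) (hhσ : IsLabel h σ) :
    ¬ ∃ g : Set (Submodule F (Fin n → F)),
        IsFlag g ∧ g ⊆ f ∧ g ⊆ h ∧ IsMinlabel g σ := by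
  rintro ⟨g, hg, hgf, hgh, hmin⟩
  obtain ⟨M, hMrep, hM⟩ := hfσ
  obtain ⟨N, hNrep, hN⟩ := hhσ
  have hMN : Mᵀ ≠ Nᵀ := by
    intro e
    obtain rfl := transpose_injective e
    exact hne ((hf.subset_of_isRep hh hMrep hNrep).antisymm (hh.subset_of_isRep hf hNrep hMrep))
  obtain ⟨j, hj⟩ := Function.ne_iff.mp hMN
  have hw : Mᵀ j - Nᵀ j ∈ colSpan M n := by
    rw [hMrep.2.1]
    trivial
  obtain ⟨a, -, ha⟩ := exists_mulVec_of_mem_colSpan hw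
  have ha0 : a ≠ 0 := by
    rintro rfl
    rw [mulVec_zero] at ha
    exact hj (sub_eq_zero.mp ha.symm)
  obtain ⟨k, -, hk, hk'⟩ := exists_pivot_mulVec hM ha0
  rw [ha] at hk hk'
  have hkj : σ k < σ j := by
    by_contra hle
    rcases (not_lt.mp hle).eq_or_lt with e | hlt
    · refine hk ?_
      rw [← e]
      simp [hMrep.2.2.1 _ _ (hM j), hNrep.2.2.1 _ _ (hN j)]
    · exact hk (by simp [(hM j).2 _ hlt, (hN j).2 _ hlt])
  have hjk : j < k := by
    by_contra hle
    rcases (not_lt.mp hle).eq_or_lt with e | hlt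
    · exact hkj.ne (congrArg σ e)
    · exact hk (by simp [hMrep.2.2.2 _ _ _ (hM k) hlt, hNrep.2.2.2 _ _ _ (hN k) hlt])
  refine lt_asymm hkj (hmin.lt_of_sameBlock hn hg hgf hMrep hM hjk fun V hV => ⟨fun hjV => ?_,
    fun hkV => (Fin.lt_def.mp hjk).trans hkV⟩)
  refine lt_of_pivot_of_mem_colSpan hM (w := Mᵀ j - Nᵀ j) ?_ hk hk'
  rw [hMrep.1 V (hgf hV)]
  refine Submodule.sub_mem _ ?_ ?_
  · rw [← hMrep.1 V (hgf hV)]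
    exact col_mem_colSpan M hjV
  · rw [← hNrep.1 V (hgh hV)]
    exact col_mem_colSpan N hjV
end
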